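/- arXiv:2505.10097 — 6 statements merged into one kernel-verified Lean document; each statement's English description precedes it below -/
import Mathlib

section
/- Let s, k, r be integers with s ≥ 2, k ≥ 3 and 1 ≤ r ≤ k−s, and set n = sk + r. Then (sk(s−1) − r)·binom(n−1, k−1) ≥ sk·(binom(n−k, k) + (k−1)·s). Equivalently, (s − 1 − r/(sk))·binom(n−1,k−1) ≥ binom(n−k,k) + (k−1)s as real numbers. -/
theorem aux_ratio (s k M j : ℕ) (h : M ≤ s * k) :
    M.choose j * (s+1)^j ≤ s^j * (M+k).choose j := by
  induction j with
  | zero => simp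
  | succ j ih =>
    have h1 := Nat.choose_succ_right_eq M j
    have h2 := Nat.choose_succ_right_eq (M+k) j
    have h3 : (M - j) * (s+1) ≤ s * (M + k - j) := by
      rcases Nat.lt_or_ge M j with hj | hj
      · rw [Nat.sub_eq_zero_of_le hj.le]; simp
      · obtain ⟨d, rfl⟩ := Nat.exists_eq_add_of_le hj
        have e1 : j + d - j = d := by omega
        have e2 : j + d + k - j = d + k := by omega
        rw [e1, e2]; nlinarith
    have h4 := Nat.mul_le_mul ih h3
    apply Nat.le_of_mul_le_mul_right _ (Nat.succ_pos j)
    calc M.choose (j+1) * (s+1)^(j+1) * (j+1)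
        = (M.choose (j+1) * (j+1)) * (s+1)^(j+1) := by ring
      _ = M.choose j * (s+1)^j * ((M - j) * (s+1)) := by rw [h1]; ring
      _ ≤ _ := h4
      _ = s^(j+1) * ((M+k).choose j * (M+k-j)) := by ring
      _ = s^(j+1) * (M+k).choose (j+1) * (j+1) := by rw [← h2]; ring

theorem aux_bern (s m : ℕ) : s^m * (s+m) ≤ s * (s+1)^m := by
  induction m with
  | zero => simp
  | succ m ih =>
    calc s^(m+1) * (s+(m+1)) = s^m * (s * (s+m+1)) := by ring
      _ ≤ s^m * ((s+m) * (s+1)) := Nat.mul_le_mul_left _ (by nlinarith)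
      _ = (s^m * (s+m)) * (s+1) := by ring
      _ ≤ (s * (s+1)^m) * (s+1) := by gcongr
      _ = _ := by ring

theorem aux_five (j : ℕ) : 5 * 2^(j+4) ≤ 3^(j+4) := by
  induction j with
  | zero => norm_num
  | succ j ih =>
    have : 3^(j+1+4) = 3 * 3^(j+4) := by ring
    have : 5 * 2^(j+1+4) = 2 * (5 * 2^(j+4)) := by ring
    omega

theorem aux_two (N j : ℕ) (h : 2 * (j+2) ≤ N) : N.choose 2 ≤ N.choose (j+2) := by
  induction j with
  | zero => simp
  | succ j ih =>
    exact (ih (by omega)).trans (Nat.choose_le_succ_of_lt_half_left (by omega))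

theorem construction1_key_inequality (s k r n : ℕ) (hs : 2 ≤ s) (hk : 3 ≤ k)
    (hr1 : 1 ≤ r) (hr2 : r + s ≤ k) (hn : n = s * k + r) :
    ((s : ℤ) * k * ((s : ℤ) - 1) - (r : ℤ)) * ((n - 1).choose (k - 1) : ℤ) ≥
      (s : ℤ) * k * (((n - k).choose k : ℤ) + ((k : ℤ) - 1) * (s : ℤ)) := by
  obtain ⟨t, rfl⟩ := Nat.exists_eq_add_of_le' (show 1 ≤ s by omega)
  obtain ⟨q, rfl⟩ := Nat.exists_eq_add_of_le' (show 1 ≤ k by omega)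
  obtain ⟨u, rfl⟩ := Nat.exists_eq_add_of_le' hr1
  have hn1 : n - 1 = (t * (q+1) + u) + (q+1) := by
    have : (t+1)*(q+1) = t*(q+1) + (q+1) := by ring
    omega
  have hn2 : n - (q+1) = (t * (q+1) + u) + 1 := by
    have : (t+1)*(q+1) = t*(q+1) + (q+1) := by ring
    omega
  rw [hn1, hn2, Nat.add_sub_cancel]
  have hrat := aux_ratio (t+1) (q+1) (t * (q+1) + u) q (by nlinarith)
  have hD := Nat.add_one_mul_choose_eq (t * (q+1) + u) q
  have hB : ((t * (q+1) + u) + (q+1)).choose 2 ≤ ((t * (q+1) + u) + (q+1)).choose q := by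
    obtain ⟨p, rfl⟩ := Nat.exists_eq_add_of_le' (show 2 ≤ q by omega)
    apply aux_two
    nlinarith
  have hB2 : (t+1)*(q+1)*((t+1)*(q+1) - 1 : ℤ) ≤
      2 * (((t * (q+1) + u) + (q+1)).choose q : ℤ) := by
    have h2 := Nat.choose_succ_right_eq ((t * (q+1) + u) + (q+1)) 1
    rw [Nat.choose_one_right] at h2
    have e : (t * (q+1) + u) + (q+1) - 1 = (t * (q+1) + u) + q := by omega
    rw [e] at h2
    zify at h2 hB
    have : (0:ℤ) ≤ t * q := by positivity
    nlinarith
  by_cases hsm : t = 1 ∧ q < 4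
  · obtain ⟨rfl, hq⟩ := hsm
    have hq2 : 2 ≤ q := by omega
    interval_cases q
    · have : u = 0 := by omega
      subst this; decide
    · have : u < 2 := by omega
      interval_cases u <;> decide
  generalize hBB : ((t * (q+1) + u) + (q+1)).choose q = B at *
  generalize (t * (q+1) + u + 1).choose (q+1) = D at *
  generalize (t * (q+1) + u).choose q = A at *
  by_cases ht : t = 1
  · subst ht
    have hA : 5 * A ≤ B := by
      obtain ⟨p, rfl⟩ := Nat.exists_eq_add_of_le' (show 4 ≤ q by omega)
      have h5 := aux_five p
      apply Nat.le_of_mul_le_mul_left _ (show 0 < 2^(p+4) by positivity)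
      norm_num at hrat
      nlinarith
    clear hrat hB hBB
    push_cast
    zify at hD hA hr2
    have h1 := mul_le_mul_of_nonneg_left hA (show (0:ℤ) ≤ 2*(q+1+u+1) by positivity)
    have h2 : ((q:ℤ)+15) * B ≤ (8*(q+1)-7*(u+1)) * B :=
      mul_le_mul_of_nonneg_right (by push_cast at hr2; linarith) (by positivity)
    have h3 := mul_le_mul_of_nonneg_left hB2 (show (0:ℤ) ≤ 7 by norm_num)
    have h4 : (0:ℤ) ≤ q * B := by positivity
    push_cast at *
    nlinarith
  · have hA : 2 * A ≤ B := by
      have h5 := aux_bern (t+1) q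
      have h6 : (t+1)^q * 2 ≤ (t+1+1)^q := by
        apply Nat.le_of_mul_le_mul_left _ (show 0 < t+1 by positivity)
        refine le_trans ?_ h5
        have : (t+1)^q * (2*(t+1)) ≤ (t+1)^q * (t+1+q) := by gcongr; omega
        linarith
      apply Nat.le_of_mul_le_mul_left _ (show 0 < (t+1)^q by positivity)
      nlinarith
    clear hrat hB hBB
    have ht2 : 2 ≤ t := by omega
    push_cast
    zify at hD hA hr2 ht2
    push_cast at *
    have h1 := mul_le_mul_of_nonneg_left hA
      (show (0:ℤ) ≤ (t+1)*(t*(q+1)+u+1) by positivity)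
    have h2 : ((t:ℤ)+1)*(t+1) * B ≤ ((t+1)*t*(q+1)-(t+3)*(u+1)) * B := by
      apply mul_le_mul_of_nonneg_right _ (by positivity)
      have h7 := mul_le_mul_of_nonneg_left hr2 (show (0:ℤ) ≤ t+3 by positivity)
      have h8 : (0:ℤ) ≤ (t^2-3) * (q+1) := by
        apply mul_nonneg _ (by positivity)
        nlinarith
      nlinarith
    have h3 : 2*((q:ℤ)+1)*q ≤ B := by
      have h9 : (3*((q:ℤ)+1))*(3*(q+1)-1) ≤ (t+1)*(q+1)*((t+1)*(q+1) - 1) := by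
        have : 3*((q:ℤ)+1) ≤ (t+1)*(q+1) := by gcongr; linarith
        apply mul_le_mul this (by linarith) (by linarith) (by positivity)
      nlinarith
    have h4 := mul_le_mul_of_nonneg_left h3 (show (0:ℤ) ≤ (t+1)*(t+1) by positivity)
    have h5 : ((t:ℤ)+1) * ((t*(q+1)+u+1)*A) = (t+1)*(D*(q+1)) := by rw [hD]
    linarith
end

section
/- Let s, k, r be integers with 1 ≤ r ≤ k−1, set n = sk + r and l = ⌈(n−1)/(2(k−1))⌉, and suppose that (k ≥ 4 and s ≥ 7), or (k = 3 and s ≥ 17), or (k ≥ 7 and s = 6). Then, as integers, (s − l − 1)·binom(n,k) ≥ s·binom(⌊n/2⌋, k) + s·l·⌈n/2⌉. -/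
theorem aux_desc (m k : ℕ) : 2 ^ k * m.descFactorial k ≤ (2 * m).descFactorial k := by
  induction k with
  | zero => simp
  | succ k ih =>
    rw [Nat.descFactorial_succ, Nat.descFactorial_succ]
    calc 2 ^ (k + 1) * ((m - k) * m.descFactorial k)
        = (2 * (m - k)) * (2 ^ k * m.descFactorial k) := by ring
      _ ≤ (2 * m - k) * (2 * m).descFactorial k := Nat.mul_le_mul (by omega) ih

theorem aux_choose (n k : ℕ) : 2 ^ k * (n / 2).choose k ≤ n.choose k := by
  have h := aux_desc (n / 2) k
  rw [Nat.descFactorial_eq_factorial_mul_choose, Nat.descFactorial_eq_factorial_mul_choose] at h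
  have h2 : 2 ^ k * (n / 2).choose k ≤ (2 * (n / 2)).choose k := by
    refine le_of_mul_le_mul_left (a := k.factorial) ?_ (Nat.factorial_pos k)
    calc _ = 2 ^ k * (k.factorial * (n / 2).choose k) := by ring
      _ ≤ _ := h
  exact h2.trans (Nat.choose_le_choose k (by omega))

theorem aux_final (c s l C B h : ℕ) (h0 : l + 1 ≤ s) (h1 : (s : ℤ) ≤ c * ((s : ℤ) - l - 1))
    (h2 : c * (B + l * h) ≤ C) :
    ((s : ℤ) - (l : ℤ) - 1) * (C : ℤ) ≥ (s : ℤ) * (B : ℤ) + (s : ℤ) * (l : ℤ) * (h : ℤ) := by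
  have h2' : (c : ℤ) * (B + l * h) ≤ C := by exact_mod_cast h2
  have hD : (0 : ℤ) ≤ (s : ℤ) - l - 1 := by
    omega
  have h3 := mul_le_mul_of_nonneg_left h2' hD
  have h4 := mul_le_mul_of_nonneg_right h1 (show (0 : ℤ) ≤ B + l * h by positivity)
  nlinarith

theorem aux_choose3 (n : ℕ) (hn : 52 ≤ n) : 7 * (n + 1) * (n + 2) ≤ n.choose 3 := by
  obtain ⟨a, rfl⟩ := Nat.exists_eq_add_of_le hn
  have h := Nat.descFactorial_eq_factorial_mul_choose (52 + a) 3
  simp only [Nat.descFactorial_succ, Nat.descFactorial_zero, Nat.factorial] at h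
  have e1 : 52 + a - 2 = 50 + a := by omega
  have e2 : 52 + a - 1 = 51 + a := by omega
  rw [e1, e2] at h
  norm_num at h
  nlinarith [sq_nonneg a, pow_nonneg (Nat.zero_le a) 3]

theorem aux_choose4 (n : ℕ) (hn : 29 ≤ n) : 72 * n * (n + 1) ≤ 7 * n.choose 4 := by
  obtain ⟨a, rfl⟩ := Nat.exists_eq_add_of_le hn
  have h := Nat.descFactorial_eq_factorial_mul_choose (29 + a) 4
  simp only [Nat.descFactorial_succ, Nat.descFactorial_zero, Nat.factorial] at h
  have e0 : 29 + a - 3 = 26 + a := by omega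
  have e1 : 29 + a - 2 = 27 + a := by omega
  have e2 : 29 + a - 1 = 28 + a := by omega
  rw [e0, e1, e2] at h
  norm_num at h
  nlinarith [sq_nonneg a, pow_nonneg (Nat.zero_le a) 3, pow_nonneg (Nat.zero_le a) 4]

theorem aux_big (s k r n l : ℕ) (hr2 : r ≤ k - 1)
    (hn : n = s * k + r) (hl : l = (n - 1) ⌈/⌉ (2 * (k - 1)))
    (hcase : (4 ≤ k ∧ 7 ≤ s) ∨ (7 ≤ k ∧ s = 6)) (hr1 : 1 ≤ r) :
    ((s : ℤ) - (l : ℤ) - 1) * (n.choose k : ℤ) ≥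
      (s : ℤ) * ((n / 2).choose k : ℤ) + (s : ℤ) * (l : ℤ) * (((n + 1) / 2 : ℕ) : ℤ) := by
  have hk : 4 ≤ k := by omega
  have hs : 6 ≤ s := by omega
  have hn29 : 29 ≤ n := by rcases hcase with h | h <;> nlinarith
  have h2k : 2 * k ≤ n := by nlinarith
  have hsn : s ≤ n := by nlinarith
  obtain ⟨j, rfl⟩ : ∃ j, k = j + 1 := ⟨k - 1, by omega⟩
  obtain ⟨t, ht⟩ : ∃ t, t = s - 1 - (s + 8) / 9 := ⟨_, rfl⟩
  have hlt : l ≤ t := by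
    rw [hl, ceilDiv_le_iff_le_mul (by omega)]
    obtain ⟨u, hu⟩ : ∃ u, 2 * t = s + 1 + u := ⟨2 * t - (s + 1), by omega⟩
    have hu2 : s - 1 ≤ u * j := by
      rcases hcase with h | h
      · have : s - 1 ≤ u * 3 := by omega
        exact this.trans (Nat.mul_le_mul_left u (by omega))
      · have : 1 ≤ u := by omega
        calc s - 1 ≤ 1 * j := by omega
          _ ≤ u * j := Nat.mul_le_mul_right j this
    have e : 2 * (j + 1 - 1) * t = s * j + j + u * j := by
      calc 2 * (j + 1 - 1) * t = j * (2 * t) := by simp; ring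
        _ = _ := by rw [hu]; ring
    have e2 : n = s * j + s + r := by rw [hn]; ring
    omega
  apply aux_final 9
  · omega
  · omega
  · have hc := aux_choose n (j + 1)
    have hp : 2 ^ 4 ≤ 2 ^ (j + 1) := Nat.pow_le_pow_right (by norm_num) hk
    have hc' := (Nat.mul_le_mul_right ((n / 2).choose (j + 1)) hp).trans hc
    have h4 := aux_choose4 n hn29
    have hmono : n.choose 4 ≤ n.choose (j + 1) := by
      have hm : ∀ i, 4 + i ≤ n / 2 → n.choose 4 ≤ n.choose (4 + i) := by
        intro i
        induction i with
        | zero => simp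
        | succ i ih =>
          intro hi
          exact (ih (by omega)).trans (Nat.choose_le_succ_of_lt_half_left (by omega))
      have := hm (j + 1 - 4) (by omega)
      rwa [show 4 + (j + 1 - 4) = j + 1 by omega] at this
    have hlh : 2 * (l * ((n + 1) / 2)) ≤ n * (n + 1) := by
      calc 2 * (l * ((n + 1) / 2)) = l * (2 * ((n + 1) / 2)) := by ring
        _ ≤ n * (n + 1) := Nat.mul_le_mul (by omega) (by omega)
    rw [mul_assoc] at h4
    omega

theorem aux_three (s r n l : ℕ) (hr2 : r ≤ 2)
    (hn : n = s * 3 + r) (hl : l = (n - 1) ⌈/⌉ (2 * (3 - 1)))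
    (hs : 17 ≤ s) (hr1 : 1 ≤ r) :
    ((s : ℤ) - (l : ℤ) - 1) * (n.choose 3 : ℤ) ≥
      (s : ℤ) * ((n / 2).choose 3 : ℤ) + (s : ℤ) * (l : ℤ) * (((n + 1) / 2 : ℕ) : ℤ) := by
  have hlt : l ≤ s - 1 - (s + 6) / 7 := by
    rw [hl, ceilDiv_le_iff_le_mul (by omega)]
    omega
  have hl4 : l ≤ (n + 2) / 4 := by
    rw [hl, ceilDiv_le_iff_le_mul (by omega)]
    omega
  apply aux_final 7
  · omega
  · omega
  · have hc := aux_choose n 3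
    have h3 := aux_choose3 n (by omega)
    have hlh : 8 * (l * ((n + 1) / 2)) ≤ (n + 2) * (n + 1) := by
      calc 8 * (l * ((n + 1) / 2)) = (4 * l) * (2 * ((n + 1) / 2)) := by ring
        _ ≤ _ := Nat.mul_le_mul (by omega) (by omega)
    rw [mul_assoc, mul_comm (n + 1)] at h3
    omega

/-- The key estimate of Lemma 7 (Construction 2): for integers `s, k, r` with
`1 ≤ r ≤ k−1`, `n = sk + r`, `l = ⌈(n−1)/(2(k−1))⌉`, and `(k ≥ 4 ∧ s ≥ 7)` or
`(k = 3 ∧ s ≥ 17)` or `(k ≥ 7 ∧ s = 6)`, one has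
`(s − l − 1)·binom(n,k) ≥ s·binom(⌊n/2⌋,k) + s·l·⌈n/2⌉`. -/
theorem construction2_key_inequality (s k r n l : ℕ) (hr1 : 1 ≤ r) (hr2 : r ≤ k - 1)
    (hn : n = s * k + r) (hl : l = (n - 1) ⌈/⌉ (2 * (k - 1)))
    (hcase : (4 ≤ k ∧ 7 ≤ s) ∨ (k = 3 ∧ 17 ≤ s) ∨ (7 ≤ k ∧ s = 6)) :
    ((s : ℤ) - (l : ℤ) - 1) * (n.choose k : ℤ) ≥
      (s : ℤ) * ((n / 2).choose k : ℤ) + (s : ℤ) * (l : ℤ) * (((n + 1) / 2 : ℕ) : ℤ) := by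
  rcases hcase with h | ⟨rfl, h⟩ | h
  · exact aux_big s k r n l hr2 hn hl (Or.inl h) hr1
  · exact aux_three s r n l hr2 hn hl h hr1
  · exact aux_big s k r n l hr2 hn hl (Or.inr h) hr1
end

section
/- Let s, k, r be integers with k−s+1 ≤ r ≤ k−1, and suppose one of the following holds: (a) s = 2, k ≥ 3 (hence r = k−1); (b) s = 3 and k ≥ 4; (c) s = 4 and k ≥ 7; (d) s = 4, k = 6 and k−3 ≤ r ≤ k−2; (e) s = 5 and k ≥ 9; (f) s = 5, k = 8 and r = 4. Then ((s²−s)k − r)·binom(sk+r−1, k−1) ≥ s²·k·(binom((s−1)k+r−1, k) + 1). -/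
/-- Induction step: the left side grows at least as fast as the right side. -/
lemma c3_step (P P' k k' A A' B B' q ua va ub vb : ℕ) (hA : A' * ua = A * va)
    (hB : B' * ub = B * vb) (hP : 0 < P) (hk : 0 < k) (hua : 0 < ua) (hub : 0 < ub)
    (hq : P * k' * (ua * vb) ≤ P' * k * (va * ub)) (huv : ub ≤ vb)
    (ih : q * k * (B + 1) ≤ P * A) : q * k' * (B' + 1) ≤ P' * A' := by
  have hpos : 0 < P * k * ua * ub := by positivity
  refine Nat.le_of_mul_le_mul_left ?_ hpos
  calc P * k * ua * ub * (q * k' * (B' + 1))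
      = P * k * ua * q * k' * (B' * ub + ub) := by ring
    _ ≤ P * k * ua * q * k' * (B' * ub + vb) := by gcongr
    _ = P * k' * (ua * vb) * (q * k * (B + 1)) := by rw [hB]; ring
    _ ≤ P' * k * (va * ub) * (P * A) := Nat.mul_le_mul hq ih
    _ = P * k * ub * P' * (A * va) := by ring
    _ = P * k * ua * ub * (P' * A') := by rw [← hA]; ring

lemma c3_choose (a b t : ℕ) :
    (a + 1 + (b + t)).choose (a + 1) * ((a + 1) * (b + 1).ascFactorial t)
      = (a + b).choose a * (a + b + 1).ascFactorial (t + 1) := by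
  have h1 := Nat.add_choose_mul_factorial_mul_factorial (a + 1) (b + t)
  rw [← Nat.choose_symm_add] at h1
  have h2 := Nat.add_choose_mul_factorial_mul_factorial a b
  rw [← Nat.choose_symm_add] at h2
  have h3 := Nat.factorial_mul_ascFactorial b t
  have h4 := Nat.factorial_mul_ascFactorial (a + b) (t + 1)
  have e : a + 1 + (b + t) = a + b + (t + 1) := by ring
  rw [← h3, Nat.factorial_succ a] at h1
  rw [← h2] at h4
  have hpos : 0 < a.factorial * b.factorial := by positivity
  refine Nat.eq_of_mul_eq_mul_left hpos ?_
  rw [e] at h1 ⊢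
  rw [← h4] at h1
  linarith [h1]

/-- A whole family `k = m + c + 1`, `s = t + 1`, with `P m = p * m + p0`. -/
lemma c3_family (t c bA bB p p0 q : ℕ) (hp0 : 0 < p0)
    (hq : ∀ m : ℕ, (p * m + p0) * (m + c + 2) *
        (((m + c + 1) * ((t + 1) * m + bA + 1).ascFactorial (t + 1)) *
          (m + c + 1 + (t * m + bB) + 1).ascFactorial (t + 1)) ≤
      (p * (m + 1) + p0) * (m + c + 1) *
        ((m + c + ((t + 1) * m + bA) + 1).ascFactorial (t + 2) *
          ((m + c + 2) * (t * m + bB + 1).ascFactorial t)))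
    (huv : ∀ m : ℕ, (m + c + 2) * (t * m + bB + 1).ascFactorial t ≤
      (m + c + 1 + (t * m + bB) + 1).ascFactorial (t + 1))
    (h0 : q * (c + 1) * ((c + 1 + bB).choose (c + 1) + 1) ≤ p0 * (c + bA).choose c) (m : ℕ) :
    q * (m + c + 1) * ((m + c + 1 + (t * m + bB)).choose (m + c + 1) + 1) ≤
      (p * m + p0) * (m + c + ((t + 1) * m + bA)).choose (m + c) := by
  induction m with
  | zero => simpa using h0
  | succ m ih =>
    have hA := c3_choose (m + c) ((t + 1) * m + bA) (t + 1)
    have hB := c3_choose (m + c + 1) (t * m + bB) t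
    have eA : m + 1 + c + ((t + 1) * (m + 1) + bA)
      = m + c + 1 + ((t + 1) * m + bA + (t + 1)) := by ring
    have eB : m + 1 + c + 1 + (t * (m + 1) + bB)
      = m + c + 1 + 1 + (t * m + bB + t) := by ring
    have e1 : m + 1 + c = m + c + 1 := by ring
    rw [eA, eB, e1]
    exact c3_step _ _ _ _ _ _ _ _ q _ _ _ _ hA hB (by positivity) (by positivity)
      (by positivity) (by positivity) (hq m) (huv m) ih

lemma c3_fam_2_1 (m : ℕ) :
    4 * (m + 2 + 1) * ((m + 2 + 1 + (1 * m + 1)).choose (m + 2 + 1) + 1) ≤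
      (1 * m + 4) * (m + 2 + ((1 + 1) * m + 5)).choose (m + 2) := by
  refine c3_family 1 2 5 1 1 4 4 (by norm_num) ?_ ?_ ?_ m
  · intro m
    simp only [Nat.ascFactorial]
    zify
    rw [← sub_nonneg]
    ring_nf
    positivity
  · intro m
    simp only [Nat.ascFactorial]
    zify
    rw [← sub_nonneg]
    ring_nf
    positivity
  · norm_num [Nat.choose_eq_descFactorial_div_factorial, Nat.descFactorial, Nat.factorial]

lemma c3_fam_3_1 (m : ℕ) :
    9 * (m + 3 + 1) * ((m + 3 + 1 + (2 * m + 6)).choose (m + 3 + 1) + 1) ≤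
      (5 * m + 21) * (m + 3 + ((2 + 1) * m + 11)).choose (m + 3) := by
  refine c3_family 2 3 11 6 5 21 9 (by norm_num) ?_ ?_ ?_ m
  · intro m
    simp only [Nat.ascFactorial]
    zify
    rw [← sub_nonneg]
    ring_nf
    positivity
  · intro m
    simp only [Nat.ascFactorial]
    zify
    rw [← sub_nonneg]
    ring_nf
    positivity
  · norm_num [Nat.choose_eq_descFactorial_div_factorial, Nat.descFactorial, Nat.factorial]

lemma c3_fam_3_2 (m : ℕ) :
    9 * (m + 3 + 1) * ((m + 3 + 1 + (2 * m + 5)).choose (m + 3 + 1) + 1) ≤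
      (5 * m + 22) * (m + 3 + ((2 + 1) * m + 10)).choose (m + 3) := by
  refine c3_family 2 3 10 5 5 22 9 (by norm_num) ?_ ?_ ?_ m
  · intro m
    simp only [Nat.ascFactorial]
    zify
    rw [← sub_nonneg]
    ring_nf
    positivity
  · intro m
    simp only [Nat.ascFactorial]
    zify
    rw [← sub_nonneg]
    ring_nf
    positivity
  · norm_num [Nat.choose_eq_descFactorial_div_factorial, Nat.descFactorial, Nat.factorial]

lemma c3_fam_4_1 (m : ℕ) :
    16 * (m + 6 + 1) * ((m + 6 + 1 + (3 * m + 19)).choose (m + 6 + 1) + 1) ≤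
      (11 * m + 78) * (m + 6 + ((3 + 1) * m + 27)).choose (m + 6) := by
  refine c3_family 3 6 27 19 11 78 16 (by norm_num) ?_ ?_ ?_ m
  · intro m
    simp only [Nat.ascFactorial]
    zify
    rw [← sub_nonneg]
    ring_nf
    positivity
  · intro m
    simp only [Nat.ascFactorial]
    zify
    rw [← sub_nonneg]
    ring_nf
    positivity
  · norm_num [Nat.choose_eq_descFactorial_div_factorial, Nat.descFactorial, Nat.factorial]

lemma c3_fam_4_2 (m : ℕ) :
    16 * (m + 6 + 1) * ((m + 6 + 1 + (3 * m + 18)).choose (m + 6 + 1) + 1) ≤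
      (11 * m + 79) * (m + 6 + ((3 + 1) * m + 26)).choose (m + 6) := by
  refine c3_family 3 6 26 18 11 79 16 (by norm_num) ?_ ?_ ?_ m
  · intro m
    simp only [Nat.ascFactorial]
    zify
    rw [← sub_nonneg]
    ring_nf
    positivity
  · intro m
    simp only [Nat.ascFactorial]
    zify
    rw [← sub_nonneg]
    ring_nf
    positivity
  · norm_num [Nat.choose_eq_descFactorial_div_factorial, Nat.descFactorial, Nat.factorial]

lemma c3_fam_4_3 (m : ℕ) :
    16 * (m + 6 + 1) * ((m + 6 + 1 + (3 * m + 17)).choose (m + 6 + 1) + 1) ≤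
      (11 * m + 80) * (m + 6 + ((3 + 1) * m + 25)).choose (m + 6) := by
  refine c3_family 3 6 25 17 11 80 16 (by norm_num) ?_ ?_ ?_ m
  · intro m
    simp only [Nat.ascFactorial]
    zify
    rw [← sub_nonneg]
    ring_nf
    positivity
  · intro m
    simp only [Nat.ascFactorial]
    zify
    rw [← sub_nonneg]
    ring_nf
    positivity
  · norm_num [Nat.choose_eq_descFactorial_div_factorial, Nat.descFactorial, Nat.factorial]

lemma c3_fam_5_1 (m : ℕ) :
    25 * (m + 8 + 1) * ((m + 8 + 1 + (4 * m + 34)).choose (m + 8 + 1) + 1) ≤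
      (19 * m + 172) * (m + 8 + ((4 + 1) * m + 44)).choose (m + 8) := by
  refine c3_family 4 8 44 34 19 172 25 (by norm_num) ?_ ?_ ?_ m
  · intro m
    simp only [Nat.ascFactorial]
    zify
    rw [← sub_nonneg]
    ring_nf
    positivity
  · intro m
    simp only [Nat.ascFactorial]
    zify
    rw [← sub_nonneg]
    ring_nf
    positivity
  · norm_num [Nat.choose_eq_descFactorial_div_factorial, Nat.descFactorial, Nat.factorial]

lemma c3_fam_5_2 (m : ℕ) :
    25 * (m + 8 + 1) * ((m + 8 + 1 + (4 * m + 33)).choose (m + 8 + 1) + 1) ≤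
      (19 * m + 173) * (m + 8 + ((4 + 1) * m + 43)).choose (m + 8) := by
  refine c3_family 4 8 43 33 19 173 25 (by norm_num) ?_ ?_ ?_ m
  · intro m
    simp only [Nat.ascFactorial]
    zify
    rw [← sub_nonneg]
    ring_nf
    positivity
  · intro m
    simp only [Nat.ascFactorial]
    zify
    rw [← sub_nonneg]
    ring_nf
    positivity
  · norm_num [Nat.choose_eq_descFactorial_div_factorial, Nat.descFactorial, Nat.factorial]

lemma c3_fam_5_3 (m : ℕ) :
    25 * (m + 8 + 1) * ((m + 8 + 1 + (4 * m + 32)).choose (m + 8 + 1) + 1) ≤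
      (19 * m + 174) * (m + 8 + ((4 + 1) * m + 42)).choose (m + 8) := by
  refine c3_family 4 8 42 32 19 174 25 (by norm_num) ?_ ?_ ?_ m
  · intro m
    simp only [Nat.ascFactorial]
    zify
    rw [← sub_nonneg]
    ring_nf
    positivity
  · intro m
    simp only [Nat.ascFactorial]
    zify
    rw [← sub_nonneg]
    ring_nf
    positivity
  · norm_num [Nat.choose_eq_descFactorial_div_factorial, Nat.descFactorial, Nat.factorial]

lemma c3_fam_5_4 (m : ℕ) :
    25 * (m + 8 + 1) * ((m + 8 + 1 + (4 * m + 31)).choose (m + 8 + 1) + 1) ≤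
      (19 * m + 175) * (m + 8 + ((4 + 1) * m + 41)).choose (m + 8) := by
  refine c3_family 4 8 41 31 19 175 25 (by norm_num) ?_ ?_ ?_ m
  · intro m
    simp only [Nat.ascFactorial]
    zify
    rw [← sub_nonneg]
    ring_nf
    positivity
  · intro m
    simp only [Nat.ascFactorial]
    zify
    rw [← sub_nonneg]
    ring_nf
    positivity
  · norm_num [Nat.choose_eq_descFactorial_div_factorial, Nat.descFactorial, Nat.factorial]

/-- The key estimate of Lemma 8 (Construction 3): for integers `s, k, r` with
`k−s+1 ≤ r ≤ k−1` in one of the listed parameter ranges, one has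
`((s²−s)k − r)·binom(sk+r−1,k−1) ≥ s²k·(binom((s−1)k+r−1,k) + 1)`. -/
theorem construction3_key_inequality (s k r : ℕ)
    (hr1 : k + 1 ≤ r + s) (hr2 : r ≤ k - 1)
    (hcase : (s = 2 ∧ 3 ≤ k) ∨ (s = 3 ∧ 4 ≤ k) ∨ (s = 4 ∧ 7 ≤ k) ∨
      (s = 4 ∧ k = 6 ∧ k - 3 ≤ r ∧ r ≤ k - 2) ∨ (s = 5 ∧ 9 ≤ k) ∨
      (s = 5 ∧ k = 8 ∧ r = 4)) :
    (((s : ℤ) ^ 2 - (s : ℤ)) * (k : ℤ) - (r : ℤ)) * ((s * k + r - 1).choose (k - 1) : ℤ) ≥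
      (s : ℤ) ^ 2 * (k : ℤ) * ((((s - 1) * k + r - 1).choose k : ℤ) + 1) := by
  rcases hcase with ⟨rfl, hk⟩ | ⟨rfl, hk⟩ | ⟨rfl, hk⟩ | ⟨rfl, rfl, h1, h2⟩ | ⟨rfl, hk⟩ | ⟨rfl, rfl, rfl⟩
  · obtain ⟨m, rfl⟩ : ∃ m, k = m + 3 := ⟨k - 3, by omega⟩
    have hc : r = m + 2 := by omega
    rcases hc with hc
    · obtain rfl : r = m + 2 := by omega
      have h := c3_fam_2_1 m
      rw [show 2 * (m + 3) + (m + 2) - 1 = m + 2 + ((1 + 1) * m + 5) by omega,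
        show (2 - 1) * (m + 3) + (m + 2) - 1 = m + 2 + 1 + (1 * m + 1) by omega,
        show m + 3 - 1 = m + 2 by omega, show m + 3 = m + 2 + 1 by omega]
      zify at h
      push_cast
      linarith [h]
  · obtain ⟨m, rfl⟩ : ∃ m, k = m + 4 := ⟨k - 4, by omega⟩
    have hc : r = m + 3 ∨ r = m + 2 := by omega
    rcases hc with hc | hc
    · obtain rfl : r = m + 3 := by omega
      have h := c3_fam_3_1 m
      rw [show 3 * (m + 4) + (m + 3) - 1 = m + 3 + ((2 + 1) * m + 11) by omega,
        show (3 - 1) * (m + 4) + (m + 3) - 1 = m + 3 + 1 + (2 * m + 6) by omega,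
        show m + 4 - 1 = m + 3 by omega, show m + 4 = m + 3 + 1 by omega]
      zify at h
      push_cast
      linarith [h]
    · obtain rfl : r = m + 2 := by omega
      have h := c3_fam_3_2 m
      rw [show 3 * (m + 4) + (m + 2) - 1 = m + 3 + ((2 + 1) * m + 10) by omega,
        show (3 - 1) * (m + 4) + (m + 2) - 1 = m + 3 + 1 + (2 * m + 5) by omega,
        show m + 4 - 1 = m + 3 by omega, show m + 4 = m + 3 + 1 by omega]
      zify at h
      push_cast
      linarith [h]
  · obtain ⟨m, rfl⟩ : ∃ m, k = m + 7 := ⟨k - 7, by omega⟩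
    have hc : r = m + 6 ∨ r = m + 5 ∨ r = m + 4 := by omega
    rcases hc with hc | hc | hc
    · obtain rfl : r = m + 6 := by omega
      have h := c3_fam_4_1 m
      rw [show 4 * (m + 7) + (m + 6) - 1 = m + 6 + ((3 + 1) * m + 27) by omega,
        show (4 - 1) * (m + 7) + (m + 6) - 1 = m + 6 + 1 + (3 * m + 19) by omega,
        show m + 7 - 1 = m + 6 by omega, show m + 7 = m + 6 + 1 by omega]
      zify at h
      push_cast
      linarith [h]
    · obtain rfl : r = m + 5 := by omega
      have h := c3_fam_4_2 m
      rw [show 4 * (m + 7) + (m + 5) - 1 = m + 6 + ((3 + 1) * m + 26) by omega,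
        show (4 - 1) * (m + 7) + (m + 5) - 1 = m + 6 + 1 + (3 * m + 18) by omega,
        show m + 7 - 1 = m + 6 by omega, show m + 7 = m + 6 + 1 by omega]
      zify at h
      push_cast
      linarith [h]
    · obtain rfl : r = m + 4 := by omega
      have h := c3_fam_4_3 m
      rw [show 4 * (m + 7) + (m + 4) - 1 = m + 6 + ((3 + 1) * m + 25) by omega,
        show (4 - 1) * (m + 7) + (m + 4) - 1 = m + 6 + 1 + (3 * m + 17) by omega,
        show m + 7 - 1 = m + 6 by omega, show m + 7 = m + 6 + 1 by omega]
      zify at h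
      push_cast
      linarith [h]
  · have hc : r = 3 ∨ r = 4 := by omega
    rcases hc with rfl | rfl <;>
      norm_num [Nat.choose_eq_descFactorial_div_factorial, Nat.descFactorial, Nat.factorial]
  · obtain ⟨m, rfl⟩ : ∃ m, k = m + 9 := ⟨k - 9, by omega⟩
    have hc : r = m + 8 ∨ r = m + 7 ∨ r = m + 6 ∨ r = m + 5 := by omega
    rcases hc with hc | hc | hc | hc
    · obtain rfl : r = m + 8 := by omega
      have h := c3_fam_5_1 m
      rw [show 5 * (m + 9) + (m + 8) - 1 = m + 8 + ((4 + 1) * m + 44) by omega,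
        show (5 - 1) * (m + 9) + (m + 8) - 1 = m + 8 + 1 + (4 * m + 34) by omega,
        show m + 9 - 1 = m + 8 by omega, show m + 9 = m + 8 + 1 by omega]
      zify at h
      push_cast
      linarith [h]
    · obtain rfl : r = m + 7 := by omega
      have h := c3_fam_5_2 m
      rw [show 5 * (m + 9) + (m + 7) - 1 = m + 8 + ((4 + 1) * m + 43) by omega,
        show (5 - 1) * (m + 9) + (m + 7) - 1 = m + 8 + 1 + (4 * m + 33) by omega,
        show m + 9 - 1 = m + 8 by omega, show m + 9 = m + 8 + 1 by omega]
      zify at h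
      push_cast
      linarith [h]
    · obtain rfl : r = m + 6 := by omega
      have h := c3_fam_5_3 m
      rw [show 5 * (m + 9) + (m + 6) - 1 = m + 8 + ((4 + 1) * m + 42) by omega,
        show (5 - 1) * (m + 9) + (m + 6) - 1 = m + 8 + 1 + (4 * m + 32) by omega,
        show m + 9 - 1 = m + 8 by omega, show m + 9 = m + 8 + 1 by omega]
      zify at h
      push_cast
      linarith [h]
    · obtain rfl : r = m + 5 := by omega
      have h := c3_fam_5_4 m
      rw [show 5 * (m + 9) + (m + 5) - 1 = m + 8 + ((4 + 1) * m + 41) by omega,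
        show (5 - 1) * (m + 9) + (m + 5) - 1 = m + 8 + 1 + (4 * m + 31) by omega,
        show m + 9 - 1 = m + 8 by omega, show m + 9 = m + 8 + 1 by omega]
      zify at h
      push_cast
      linarith [h]
  · norm_num [Nat.choose_eq_descFactorial_div_factorial, Nat.descFactorial, Nat.factorial]
end

section
/- Let k ≥ 3 and r be integers with 1 ≤ r ≤ k−2. Then, as real numbers, binom(2k+r−1, k−1) + (1/3)·(binom(2k+r−1, k) − binom(k+r, k)) − (2/3)·(k−1) − (1/2)·(binom(2k+r, k) + 1) ≥ (1/12)·((3/2)^{k−1} − 8k − 2). -/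
theorem descFactorial_ratio_aux (n d : ℕ) (h : n ≤ 2 * d) (j : ℕ) :
    3 ^ j * n.descFactorial j ≤ 2 ^ j * (n + d).descFactorial j := by
  induction j with
  | zero => simp
  | succ j ih =>
    rw [Nat.descFactorial_succ, Nat.descFactorial_succ]
    have h1 : 3 * (n - j) ≤ 2 * (n + d - j) := by omega
    calc 3 ^ (j + 1) * ((n - j) * n.descFactorial j)
        = (3 * (n - j)) * (3 ^ j * n.descFactorial j) := by ring
      _ ≤ (2 * (n + d - j)) * (2 ^ j * (n + d).descFactorial j) := Nat.mul_le_mul h1 ih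
      _ = _ := by ring

theorem choose_ratio_aux (n d : ℕ) (h : n ≤ 2 * d) (j : ℕ) :
    3 ^ j * n.choose j ≤ 2 ^ j * (n + d).choose j := by
  have h1 := descFactorial_ratio_aux n d h j
  rw [Nat.descFactorial_eq_factorial_mul_choose, Nat.descFactorial_eq_factorial_mul_choose] at h1
  refine Nat.le_of_mul_le_mul_left ?_ (Nat.factorial_pos j)
  linarith

/-- The real-number estimate giving
`h_o(K̄(2k+r,k)) − χ(K̄(2k+r,k)) ≥ (1/12)(1.5^(k−1) − 8k − 2)`: for integers
`k ≥ 3` and `1 ≤ r ≤ k−2`,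
`binom(2k+r−1,k−1) + (1/3)(binom(2k+r−1,k) − binom(k+r,k)) − (2/3)(k−1)
  − (1/2)(binom(2k+r,k) + 1) ≥ (1/12)((3/2)^(k−1) − 8k − 2)`. -/
theorem gap_estimate_construction1 (k r : ℕ) (hk : 3 ≤ k) (hr1 : 1 ≤ r)
    (hr2 : r ≤ k - 2) :
    (((2 * k + r - 1).choose (k - 1) : ℝ))
      + (1 / 3) * (((2 * k + r - 1).choose k : ℝ) - ((k + r).choose k : ℝ))
      - (2 / 3) * ((k : ℝ) - 1)
      - (1 / 2) * (((2 * k + r).choose k : ℝ) + 1)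
      ≥ (1 / 12) * ((3 / 2 : ℝ) ^ (k - 1) - 8 * (k : ℝ) - 2) := by
  obtain ⟨m, rfl⟩ : ∃ m, k = m + 1 := ⟨k - 1, by omega⟩
  have e1 : 2 * (m + 1) + r - 1 = m + 1 + r + m := by omega
  have e2 : 2 * (m + 1) + r = (m + 1 + r + m) + 1 := by omega
  rw [e1, e2, Nat.choose_succ_succ, Nat.add_sub_cancel]
  have hA := choose_ratio_aux (m + 1 + r) m (by omega) m
  have hC : (m + 1 + r).choose (m + 1) ≤ (m + 1 + r).choose m := by
    have h := Nat.choose_succ_right_eq (m + 1 + r) m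
    refine Nat.le_of_mul_le_mul_right ?_ (Nat.succ_pos m)
    rw [Nat.succ_eq_add_one, h]
    exact Nat.mul_le_mul_left _ (by omega)
  have hB : (m + 1 + r + m).choose (m + 1) ≤ (m + 1 + r + m).choose m * 2 := by
    have h := Nat.choose_succ_right_eq (m + 1 + r + m) m
    refine Nat.le_of_mul_le_mul_right ?_ (Nat.succ_pos m)
    rw [Nat.succ_eq_add_one, h, mul_assoc]
    exact Nat.mul_le_mul_left _ (by omega)
  have hD : 1 ≤ (m + 1 + r).choose m := Nat.choose_pos (by omega)
  generalize (m + 1 + r + m).choose (m + 1) = B at *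
  generalize (m + 1 + r + m).choose m = A at *
  generalize (m + 1 + r).choose (m + 1) = C at *
  generalize (m + 1 + r).choose m = D at *
  have hx : (2 : ℝ) ≤ (3 / 2) ^ m := by
    calc (2 : ℝ) ≤ (3 / 2) ^ 2 := by norm_num
      _ ≤ _ := pow_le_pow_right₀ (by norm_num) (by omega)
  have hA' : (3 / 2 : ℝ) ^ m * D ≤ A := by
    have : (3 : ℝ) ^ m * D ≤ 2 ^ m * A := by exact_mod_cast hA
    rw [div_pow, div_mul_eq_mul_div, div_le_iff₀ (by positivity)]
    linarith
  have hB' : (B : ℝ) ≤ A * 2 := by exact_mod_cast hB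
  have hC' : (C : ℝ) ≤ D := by exact_mod_cast hC
  have hD' : (1 : ℝ) ≤ D := by exact_mod_cast hD
  generalize (3 / 2 : ℝ) ^ m = x at *
  push_cast
  nlinarith [mul_nonneg (sub_nonneg.2 hx) (sub_nonneg.2 hD')]
end

section
/- Let k ≥ 3 be an integer. Then, as real numbers, binom(3k−2, k−1) + (1/3)·(binom(3k−2, k) − 2·binom(2k−2, k)) − 2/3 − (1/2)·(binom(3k−1, k) + 1) ≥ (1/6)·((3/2)^{k−1} − 11). -/
theorem aux_D (n : ℕ) : (2 * n + 4).choose (n + 1) ≤ 4 * (2 * n + 2).choose n := by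
  have h1 := Nat.add_choose_mul_factorial_mul_factorial n (n + 2)
  have h2 := Nat.add_choose_mul_factorial_mul_factorial (n + 1) (n + 3)
  rw [← Nat.choose_symm_add, show n + (n + 2) = 2 * n + 2 by ring] at h1
  rw [← Nat.choose_symm_add, show n + 1 + (n + 3) = 2 * n + 4 by ring] at h2
  rw [Nat.factorial_succ (2 * n + 3), Nat.factorial_succ (2 * n + 2), ← h1,
    Nat.factorial_succ n, Nat.factorial_succ (n + 2)] at h2
  have hp : 0 < n.factorial * (n + 2).factorial := by positivity
  have h3 : (2 * n + 4).choose (n + 1) * ((n + 1) * (n + 3))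
      = (2 * n + 2).choose n * ((2 * n + 4) * (2 * n + 3)) := by
    apply Nat.eq_of_mul_eq_mul_right hp
    linear_combination h2
  have h4 : 0 < (n + 1) * (n + 3) := by positivity
  refine Nat.le_of_mul_le_mul_right ?_ h4
  rw [h3]
  nlinarith [Nat.zero_le ((2 * n + 2).choose n), Nat.zero_le ((2 * n + 2).choose n * n)]

theorem aux_A (m : ℕ) : 4 * (3 * m + 1).choose m ≤ (3 * m + 4).choose (m + 1) := by
  have h1 := Nat.add_choose_mul_factorial_mul_factorial m (2 * m + 1)
  have h2 := Nat.add_choose_mul_factorial_mul_factorial (m + 1) (2 * m + 3)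
  rw [← Nat.choose_symm_add, show m + (2 * m + 1) = 3 * m + 1 by ring] at h1
  rw [← Nat.choose_symm_add, show m + 1 + (2 * m + 3) = 3 * m + 4 by ring] at h2
  rw [Nat.factorial_succ (3 * m + 3), Nat.factorial_succ (3 * m + 2),
    Nat.factorial_succ (3 * m + 1), ← h1,
    Nat.factorial_succ m, Nat.factorial_succ (2 * m + 2), Nat.factorial_succ (2 * m + 1)] at h2
  have hp : 0 < (m + 1) * (m.factorial * (2 * m + 1).factorial) := by positivity
  have h3 : (3 * m + 4).choose (m + 1) * ((2 * m + 3) * (2 * m + 2))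
      = (3 * m + 1).choose m * (3 * (3 * m + 4) * (3 * m + 2)) := by
    apply Nat.eq_of_mul_eq_mul_right hp
    linear_combination h2
  have h4 : 0 < (2 * m + 3) * (2 * m + 2) := by positivity
  refine Nat.le_of_mul_le_mul_right ?_ h4
  rw [h3, mul_comm 4, mul_assoc]
  apply Nat.mul_le_mul_left
  nlinarith

theorem aux_main (n : ℕ) :
    4 * (2 * n + 4).choose (n + 1) + 2 ^ (n + 2) ≤ (3 * n + 7).choose (n + 2) := by
  induction n with
  | zero => decide
  | succ n ih =>
    have h1 := aux_D (n + 1)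
    have h2 := aux_A (n + 2)
    rw [show 2 * (n + 1) + 2 = 2 * n + 4 by ring] at h1
    rw [show 3 * (n + 2) + 1 = 3 * n + 7 by ring,
      show 3 * (n + 2) + 4 = 3 * (n + 1) + 7 by ring] at h2
    rw [show n + 1 + 2 = n + 2 + 1 by ring, pow_succ]
    have := Nat.zero_le (2 ^ (n + 2))
    linarith

/-- The real-number estimate giving
`h_o(K̄(3k−1,k)) − χ(K̄(3k−1,k)) ≥ (1/6)(1.5^(k−1) − 11)`: for every integer `k ≥ 3`,
`binom(3k−2,k−1) + (1/3)(binom(3k−2,k) − 2·binom(2k−2,k)) − 2/3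
  − (1/2)(binom(3k−1,k) + 1) ≥ (1/6)((3/2)^(k−1) − 11)`. -/
theorem gap_estimate_construction3 (k : ℕ) (hk : 3 ≤ k) :
    (((3 * k - 2).choose (k - 1) : ℝ))
      + (1 / 3) * (((3 * k - 2).choose k : ℝ) - 2 * ((2 * k - 2).choose k : ℝ))
      - 2 / 3
      - (1 / 2) * (((3 * k - 1).choose k : ℝ) + 1)
      ≥ (1 / 6) * ((3 / 2 : ℝ) ^ (k - 1) - 11) := by
  obtain ⟨n, rfl⟩ := Nat.exists_eq_add_of_le' hk
  rw [show 3 * (n + 3) - 2 = 3 * n + 7 by omega, show n + 3 - 1 = n + 2 by omega,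
    show 2 * (n + 3) - 2 = 2 * n + 4 by omega, show 3 * (n + 3) - 1 = 3 * n + 7 + 1 by omega]
  have hP := Nat.choose_succ_succ (3 * n + 7) (n + 2)
  have hS : (2 * n + 4).choose (n + 3) = (2 * n + 4).choose (n + 1) :=
    Nat.choose_symm_of_eq_add (by ring)
  have hR := Nat.choose_succ_right_eq (3 * n + 7) (n + 2)
  rw [show 3 * n + 7 - (n + 2) = 2 * n + 5 by omega] at hR
  have hB : (3 * n + 7).choose (n + 3) ≤ 2 * (3 * n + 7).choose (n + 2) := by
    have h4 : 0 < n + 2 + 1 := by positivity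
    refine Nat.le_of_mul_le_mul_right ?_ h4
    rw [hR]
    nlinarith [Nat.zero_le ((3 * n + 7).choose (n + 2))]
  have hM := aux_main n
  rw [hS, show (3 * n + 7 + 1).choose (n + 3) = _ from hP]
  have hpow : (3 / 2 : ℝ) ^ (n + 2) ≤ 2 ^ (n + 2) := by
    gcongr
    norm_num
  have hM' : 4 * ((2 * n + 4).choose (n + 1) : ℝ) + 2 ^ (n + 2)
      ≤ ((3 * n + 7).choose (n + 2) : ℝ) := by exact_mod_cast hM
  have hB' : ((3 * n + 7).choose (n + 3) : ℝ) ≤ 2 * ((3 * n + 7).choose (n + 2) : ℝ) := by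
    exact_mod_cast hB
  push_cast
  simp only [Nat.succ_eq_add_one, show n + 2 + 1 = n + 3 from rfl]
  linarith
end

section
/- Let n and k be integers with n ≥ 2k ≥ 4, let i and l be positive integers with i ≤ n−k+1, and let c = ⌊binom(n−i, k−1)/l⌋. Let 𝒜_i(n,k) denote the family of all k-element subsets A of [n] with i ∈ A and A \ {i} ⊆ {i+1, i+2, …, n}, so |𝒜_i(n,k)| = binom(n−i, k−1). Then 𝒜_i(n,k) can be partitioned into subfamilies P_1, …, P_c each of size l, together with one further subfamily of size binom(n−i,k−1) − c·l when l does not divide binom(n−i,k−1), such that for every 1 ≤ j ≤ c the union of the members of P_j has size at least min{n−i+1, l(k−1)+1}. -/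
/-- `𝒜_i(n,k)`: the family of all `k`-element subsets `A` of `[n] = {1,…,n}` with
`i ∈ A` and `A \ {i} ⊆ {i+1, i+2, …, n}`. -/
def kneserFamilyA (n k i : ℕ) : Finset (Finset ℕ) :=
  ((Finset.Icc 1 n).powersetCard k).filter
    (fun A => i ∈ A ∧ A \ {i} ⊆ Finset.Icc (i + 1) n)

open Finset

/-- Hall-type rounding lemma. -/
theorem hall_round {E A B : Type} [Fintype E] [Fintype A] [Fintype B]
    [DecidableEq E] [DecidableEq A] [DecidableEq B]
    (a : E → A) (b : E → B) (w : E → ℕ) (M : ℕ) (hM : 0 < M) (hw : ∀ e, w e ≤ M)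
    (ha : ∀ y, M ∣ ∑ e with a e = y, w e) (hb : ∀ z, M ∣ ∑ e with b e = z, (M - w e)) :
    ∃ s : Finset E, (∀ e, w e = 0 → e ∉ s) ∧
      (∀ y, M * #{e | e ∈ s ∧ a e = y} = ∑ e with a e = y, w e) ∧
      (∀ z, M * #{e | e ∉ s ∧ b e = z} = ∑ e with b e = z, (M - w e)) := by
  choose T hT using ha
  choose D hD using hb
  let slotA : A → Finset ((A × ℕ) ⊕ (B × ℕ)) := fun y => (range (T y)).image fun i => Sum.inl (y, i)
  let slotB : B → Finset ((A × ℕ) ⊕ (B × ℕ)) := fun z => (range (D z)).image fun i => Sum.inr (z, i)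
  have cA : ∀ y, #(slotA y) = T y := fun y => by
    rw [card_image_of_injective _ (fun i j h => by simpa using h), card_range]
  have cB : ∀ y, #(slotB y) = D y := fun y => by
    rw [card_image_of_injective _ (fun i j h => by simpa using h), card_range]
  let t : E → Finset ((A × ℕ) ⊕ (B × ℕ)) := fun e =>
    (if 0 < w e then slotA (a e) else ∅) ∪ slotB (b e)
  have hall : ∀ X : Finset E, #X ≤ #(X.biUnion t) := by
    intro X
    set Xp := X.filter (fun e => 0 < w e)
    have hsub : (Xp.image a).biUnion slotA ∪ (X.image b).biUnion slotB ⊆ X.biUnion t := by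
      intro q hq
      simp only [mem_union, mem_biUnion, mem_image] at hq ⊢
      rcases hq with ⟨y, ⟨e, he, rfl⟩, hq⟩ | ⟨y, ⟨e, he, rfl⟩, hq⟩
      · have := mem_filter.1 he
        exact ⟨e, this.1, by simp [t, this.2, hq]⟩
      · exact ⟨e, he, by simp [t, hq]⟩
    refine le_trans ?_ (card_le_card hsub)
    rw [card_union_of_disjoint, card_biUnion, card_biUnion]
    · simp only [cA, cB]
      refine Nat.le_of_mul_le_mul_left ?_ hM
      rw [mul_add, mul_sum, mul_sum]
      simp only [← hT, ← hD]
      rw [← sum_biUnion, ← sum_biUnion]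
      · have h1 : ∑ e ∈ X, w e ≤ ∑ x ∈ (image a Xp).biUnion (fun y => {e | a e = y}), w x := by
          rw [← sum_filter_add_sum_filter_not X (fun e => 0 < w e)]
          rw [sum_eq_zero (s := X.filter (fun e => ¬ 0 < w e)) (fun e he => by
            have := (mem_filter.1 he).2; omega), add_zero]
          refine sum_le_sum_of_subset ?_
          intro e he
          simp only [mem_biUnion, mem_image, mem_filter, mem_univ, true_and]
          exact ⟨a e, ⟨e, he, rfl⟩, rfl⟩
        have h2 : ∑ e ∈ X, (M - w e) ≤
            ∑ x ∈ (image b X).biUnion (fun y => {e | b e = y}), (M - w x) := by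
          refine sum_le_sum_of_subset ?_
          intro e he
          simp only [mem_biUnion, mem_image, mem_filter, mem_univ, true_and]
          exact ⟨b e, ⟨e, he, rfl⟩, rfl⟩
        have h3 : M * #X = ∑ e ∈ X, w e + ∑ e ∈ X, (M - w e) := by
          rw [← sum_add_distrib, sum_congr rfl (fun e _ => Nat.add_sub_cancel' (hw e))]
          simp [mul_comm]
        omega
      · intro y _ z _ hyz
        simp only [Function.onFun, disjoint_left, mem_filter]
        grind
      · intro y _ z _ hyz
        simp only [Function.onFun, disjoint_left, mem_filter]
        grind
    · intro y _ z _ hyz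
      simp only [Function.onFun, disjoint_left, slotB, mem_image]
      grind
    · intro y _ z _ hyz
      simp only [Function.onFun, disjoint_left, slotA, mem_image]
      grind
    · simp only [disjoint_left, slotA, slotB, mem_biUnion, mem_image]
      grind
  obtain ⟨f, finj, hf⟩ := (all_card_le_biUnion_card_iff_exists_injective t).1 hall
  let s : Finset E := {e | (f e).isLeft}
  have hA : ∀ y, #{e | e ∈ s ∧ a e = y} ≤ T y := by
    intro y
    rw [← cA y]
    refine card_le_card_of_injOn f ?_ finj.injOn
    intro e he
    simp only [coe_filter, mem_univ, true_and, Set.mem_ofPred_eq, s, mem_filter] at he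
    have := hf e
    simp only [t, mem_union] at this
    rcases this with h | h
    · split_ifs at h
      · rw [← he.2]; exact h
      · simp at h
    · simp only [slotB, mem_image] at h
      obtain ⟨i, _, h⟩ := h
      rw [← h] at he
      simp at he
  have hB : ∀ y, #{e | e ∉ s ∧ b e = y} ≤ D y := by
    intro y
    rw [← cB y]
    refine card_le_card_of_injOn f ?_ finj.injOn
    intro e he
    simp only [coe_filter, mem_univ, true_and, Set.mem_ofPred_eq, s, mem_filter] at he
    have := hf e
    simp only [t, mem_union] at this
    rcases this with h | h
    · split_ifs at h
      · simp only [slotA, mem_image] at h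
        obtain ⟨i, _, h⟩ := h
        rw [← h] at he
        simp at he
      · simp at h
    · rw [← he.2]; exact h
  have tot : ∑ y, T y + ∑ z, D z = Fintype.card E := by
    refine Nat.eq_of_mul_eq_mul_left hM ?_
    rw [mul_add, mul_sum, mul_sum]
    simp only [← hT, ← hD]
    rw [sum_fiberwise, sum_fiberwise, ← sum_add_distrib,
      sum_congr rfl (fun e _ => Nat.add_sub_cancel' (hw e))]
    simp [mul_comm]
  have sA : ∑ y, #{e | e ∈ s ∧ a e = y} = #s := by
    rw [card_eq_sum_card_fiberwise (f := a) (t := univ) (by simp)]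
    refine sum_congr rfl fun y _ => ?_
    congr 1; ext e; simp
  have sB : ∑ y, #{e | e ∉ s ∧ b e = y} = #sᶜ := by
    rw [card_eq_sum_card_fiberwise (f := b) (t := univ) (by simp)]
    refine sum_congr rfl fun y _ => ?_
    congr 1; ext e; simp
  have hs := card_add_card_compl s
  have lA := sum_le_sum (fun y (_ : y ∈ univ) => hA y)
  have lB := sum_le_sum (fun y (_ : y ∈ univ) => hB y)
  have eA := (sum_eq_sum_iff_of_le (fun y (_ : y ∈ univ) => hA y)).1 (by omega)
  have eB := (sum_eq_sum_iff_of_le (fun y (_ : y ∈ univ) => hB y)).1 (by omega)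
  refine ⟨s, ?_, ?_, ?_⟩
  · intro e he hes
    have := hf e
    simp only [t, he, mem_union] at this
    simp only [s, mem_filter] at hes
    rcases this with h | h
    · simp at h
    · simp only [slotB, mem_image] at h
      obtain ⟨i, _, h⟩ := h
      rw [← h] at hes
      simp at hes
  · intro y; rw [eA y (mem_univ _), hT]
  · intro y; rw [eB y (mem_univ _), hD]

/-- The invariant of the induction in Baranyai's theorem. -/
def BInv {E J : Type} [Fintype E] [DecidableEq J] (m r : ℕ) (cls : E → J)
    (p : ℕ) (S : E → Finset (Fin m)) : Prop :=
  (∀ e, #(S e) ≤ r) ∧ (∀ e, ∀ x ∈ S e, x.1 < p) ∧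
  (∀ Q : Finset (Fin m), (∀ x ∈ Q, x.1 < p) → #Q ≤ r →
    #{e | S e = Q} = (m - p).choose (r - #Q)) ∧
  (∀ j, m ≤ #{e | cls e = j} * r →
    (∀ x : Fin m, x.1 < p → ∃ e, cls e = j ∧ x ∈ S e) ∧
    m - p ≤ ∑ e with cls e = j, (r - #(S e))) ∧
  (∀ j, #{e | cls e = j} * r ≤ m →
    (∀ x e e', cls e = j → cls e' = j → x ∈ S e → x ∈ S e' → e = e') ∧
    ∑ e with cls e = j, (r - #(S e)) ≤ m - p)

theorem arith_ge {M T w sel σ : ℕ} (hM : 0 < M) (hw : w < M) (hσ : σ ≤ 1)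
    (h0 : w = 0 → σ = 0) (h : M * (sel + σ) = T + w) (hT : M ≤ T) :
    1 ≤ sel ∧ M - 1 + sel ≤ T := by
  constructor
  · by_contra hs
    have : sel = 0 := by omega
    subst this
    interval_cases σ
    · omega
    · have := h0; simp at h; omega
  · by_contra hc
    push Not at hc
    obtain ⟨d, rfl⟩ := Nat.exists_eq_add_of_le hT
    have h1 : M * sel ≤ M + d + w := by nlinarith
    rcases Nat.eq_zero_or_pos d with rfl | hd
    · have : M * sel < M * 2 := by omega
      have := Nat.lt_of_mul_lt_mul_left this
      omega
    · have h2 : d + 2 ≤ sel := by omega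
      have := Nat.mul_le_mul_left M h2
      nlinarith

theorem arith_le {M T w sel σ : ℕ} (hM : 0 < M) (hw : w = (M - T % M) % M) (hσ : σ ≤ 1)
    (h0 : w = 0 → σ = 0) (h : M * (sel + σ) = T + w) (hT : T ≤ M) :
    sel ≤ 1 ∧ T ≤ M - 1 + sel := by
  rcases hT.lt_or_eq with hlt | rfl
  · rw [Nat.mod_eq_of_lt hlt] at hw
    have : T + w ≤ M := by
      rcases Nat.eq_zero_or_pos T with rfl | h
      · simp at hw; omega
      · rw [Nat.mod_eq_of_lt (by omega)] at hw; omega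
    have : M * (sel + σ) ≤ M * 1 := by omega
    have := Nat.le_of_mul_le_mul_left this hM
    omega
  · simp at hw
    have := h0 hw
    subst this
    have : T * sel = T * 1 := by simp at h; omega
    have := Nat.eq_of_mul_eq_mul_left hM this
    omega

theorem sum_split {E J : Type} [Fintype E] [Fintype J] (P : E ⊕ J → Prop) [DecidablePred P]
    (f : E ⊕ J → ℕ) : ∑ x with P x, f x =
      ∑ e with P (Sum.inl e), f (Sum.inl e) + ∑ j with P (Sum.inr j), f (Sum.inr j) := by
  simp [sum_filter, Fintype.sum_sum_type]

theorem card_split {E J : Type} [Fintype E] [Fintype J] (P : E ⊕ J → Prop) [DecidablePred P] :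
    #{x | P x} = #{e | P (Sum.inl e)} + #{j | P (Sum.inr j)} := by
  simp only [card_eq_sum_ones]
  exact sum_split P fun _ => 1

theorem BInv_step {E J : Type} [Fintype E] [Fintype J] [DecidableEq E] [DecidableEq J]
    (m r : ℕ) (cls : E → J) (p : ℕ) (hp : p < m) (S : E → Finset (Fin m))
    (h : BInv m r cls p S) : ∃ S', BInv m r cls (p + 1) S' := by
  obtain ⟨hr, hlt, hcnt, hge, hle⟩ := h
  obtain ⟨M, hMp⟩ : ∃ M, m - p = M + 1 := ⟨m - p - 1, by omega⟩
  have hM' : m - (p + 1) = M := by omega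
  simp only [hM', hMp, BInv] at *
  set T : J → ℕ := fun j => ∑ e with cls e = j, (r - #(S e)) with hTdef
  let wJ : J → ℕ := fun j => (M + 1 - T j % (M + 1)) % (M + 1)
  have hwJ : ∀ j, wJ j < M + 1 := fun j => Nat.mod_lt _ (by omega)
  let a : E ⊕ J → J := Sum.elim cls id
  let b : E ⊕ J → Option (Finset (Fin m)) := Sum.elim (fun e => some (S e)) (fun _ => none)
  let w : E ⊕ J → ℕ := Sum.elim (fun e => r - #(S e)) wJ
  have hwE : ∀ e, r - #(S e) ≤ M + 1 := by
    intro e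
    have h1 := hcnt (S e) (hlt e) (hr e)
    have h2 : 0 < #{e' | S e' = S e} := card_pos.2 ⟨e, by simp⟩
    by_contra hc
    rw [h1, Nat.choose_eq_zero_of_lt (by omega)] at h2
    omega
  have hw : ∀ x, w x ≤ M + 1 := by
    rintro (e | j)
    · exact hwE e
    · exact (hwJ j).le
  have rowsum : ∀ j, ∑ x with a x = j, w x = T j + wJ j := by
    intro j
    rw [sum_split]
    have h1 : ∑ x with a (Sum.inr x) = j, w (Sum.inr x) = wJ j := by
      have h2 : ({x | a (Sum.inr x) = j} : Finset J) = {j} := by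
        ext x
        rw [mem_filter, mem_singleton]
        exact ⟨fun h => h.2, fun h => ⟨mem_univ _, h⟩⟩
      rw [h2, sum_singleton]
      rfl
    rw [h1]
    rfl
  have rowdvd : ∀ j, M + 1 ∣ T j + wJ j := by
    intro j
    have : T j % (M + 1) < M + 1 := Nat.mod_lt _ (by omega)
    simp only [wJ]
    rw [Nat.dvd_iff_mod_eq_zero, Nat.add_mod, Nat.mod_mod, ← Nat.add_mod_mod, ]
    simp only [Nat.mod_mod, Nat.add_mod_mod]
    rw [Nat.add_sub_cancel' this.le]
    simp
  have colsum : ∀ Q, ∑ x with b x = some Q, (M + 1 - w x) =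
      #{e | S e = Q} * (M + 1 - (r - #Q)) := by
    intro Q
    rw [sum_split]
    simp only [b, w, Sum.elim_inl, Sum.elim_inr, Option.some.injEq, reduceCtorEq, filter_false,
      sum_empty, add_zero]
    rw [sum_congr rfl (g := fun _ => M + 1 - (r - #Q))]
    · simp
    · intro e he
      rw [(mem_filter.1 he).2]
  have coleq : ∀ Q : Finset (Fin m), (∀ x ∈ Q, x.1 < p) → #Q ≤ r →
      ∑ x with b x = some Q, (M + 1 - w x) = (M + 1) * M.choose (r - #Q) := by
    intro Q h1 h2
    rw [colsum, hcnt Q h1 h2, ← Nat.choose_mul_succ_eq, mul_comm]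
  have coldvd : ∀ Q, M + 1 ∣ ∑ x with b x = some Q, (M + 1 - w x) := by
    intro Q
    by_cases hQ : ∃ e, S e = Q
    · obtain ⟨e, rfl⟩ := hQ
      rw [coleq _ (hlt e) (hr e)]
      exact dvd_mul_right _ _
    · rw [colsum]
      have : #{e | S e = Q} = 0 := by
        rw [card_eq_zero, filter_eq_empty_iff]
        exact fun e _ he => hQ ⟨e, he⟩
      simp [this]
  have totdvd : M + 1 ∣ ∑ x, (M + 1 - w x) := by
    have h1 : ∑ x, w x + ∑ x, (M + 1 - w x) = (M + 1) * Fintype.card (E ⊕ J) := by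
      rw [← sum_add_distrib, sum_congr rfl (fun e _ => Nat.add_sub_cancel' (hw e))]
      simp [mul_comm]
    have h2 : M + 1 ∣ ∑ x, w x := by
      rw [← sum_fiberwise univ a w]
      exact dvd_sum fun j _ => by rw [rowsum]; exact rowdvd j
    exact (Nat.dvd_add_right h2).1 (h1 ▸ dvd_mul_right _ _)
  have nonedvd : M + 1 ∣ ∑ x with b x = none, (M + 1 - w x) := by
    rw [← sum_fiberwise univ b, Fintype.sum_option] at totdvd
    exact (Nat.dvd_add_left (dvd_sum fun Q _ => coldvd Q)).1 totdvd
  obtain ⟨s, hs0, hsA, hsB⟩ := hall_round a b w (M + 1) (by omega) hw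
    (fun j => by rw [rowsum]; exact rowdvd j)
    (fun z => by cases z with
      | none => exact nonedvd
      | some Q => exact coldvd Q)
  let q : Fin m := ⟨p, hp⟩
  have hq : ∀ e, q ∉ S e := fun e he => by simpa [q] using hlt e q he
  let S' : E → Finset (Fin m) := fun e => if Sum.inl e ∈ s then insert q (S e) else S e
  have hSone : ∀ e, Sum.inl e ∈ s → S' e = insert q (S e) := fun e he => by simp [S', he]
  have hSzero : ∀ e, Sum.inl e ∉ s → S' e = S e := fun e he => by simp [S', he]
  have hqS : ∀ e, q ∈ S' e ↔ Sum.inl e ∈ s := by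
    intro e
    by_cases he : Sum.inl e ∈ s
    · simp [hSone e he, he]
    · simp [hSzero e he, he, hq]
  have hxS : ∀ e (x : Fin m), x ≠ q → (x ∈ S' e ↔ x ∈ S e) := by
    intro e x hx
    by_cases he : Sum.inl e ∈ s
    · simp [hSone e he, hx]
    · simp [hSzero e he]
  have hcard : ∀ e, r - #(S' e) + (if Sum.inl e ∈ s then 1 else 0) = r - #(S e) ∧ #(S' e) ≤ r := by
    intro e
    have h1 := hr e
    by_cases he : Sum.inl e ∈ s
    · have : w (Sum.inl e) ≠ 0 := fun h => hs0 _ h he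
      simp only [w, Sum.elim_inl] at this
      rw [hSone e he, card_insert_of_notMem (hq e)]
      simp only [he, if_true]; omega
    · rw [hSzero e he]; simp [he, h1]
  have hunsel : ∀ Q : Finset (Fin m), (∀ x ∈ Q, x.1 < p) → #Q ≤ r →
      #{e | Sum.inl e ∉ s ∧ S e = Q} = M.choose (r - #Q) := by
    intro Q h1 h2
    have := hsB (some Q)
    rw [coleq Q h1 h2, card_split] at this
    have := Nat.eq_of_mul_eq_mul_left (by omega) this
    simpa [b] using this
  have hrow : ∀ j, ∃ σ, σ ≤ 1 ∧ (wJ j = 0 → σ = 0) ∧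
      (M + 1) * (#{e | Sum.inl e ∈ s ∧ cls e = j} + σ) = T j + wJ j := by
    intro j
    refine ⟨#{j' | Sum.inr j' ∈ s ∧ j' = j}, ?_, ?_, ?_⟩
    · rw [← card_singleton j]
      exact card_le_card fun x hx => by simp at hx ⊢; exact hx.2
    · intro h0
      rw [card_eq_zero, filter_eq_empty_iff]
      rintro j' _ ⟨h1, rfl⟩
      exact hs0 (Sum.inr j') h0 h1
    · rw [← rowsum, ← hsA j, card_split (fun x => x ∈ s ∧ a x = j)]
      simp only [a, Sum.elim_inl, Sum.elim_inr, id]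
      congr!
  have hT' : ∀ j, ∑ e with cls e = j, (r - #(S' e)) + #{e | Sum.inl e ∈ s ∧ cls e = j} = T j := by
    intro j
    have : #{e | Sum.inl e ∈ s ∧ cls e = j} =
        ∑ e with cls e = j, (if Sum.inl e ∈ s then 1 else 0) := by
      rw [← card_filter, filter_filter]
      congr 1; ext e; simp [and_comm]
    rw [this, ← sum_add_distrib]
    exact sum_congr rfl fun e _ => (hcard e).1
  refine ⟨S', fun e => (hcard e).2, ?_, ?_, ?_, ?_⟩
  · intro e x hx
    by_cases hxq : x = q
    · subst hxq; simp [q]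
    · have := hlt e x ((hxS e x hxq).1 hx); omega
  · intro Q hQ hQr
    by_cases hqQ : q ∈ Q
    · set Q0 := Q.erase q with hQ0
      have hc : #Q0 + 1 = #Q := card_erase_add_one hqQ
      have hQ0lt : ∀ x ∈ Q0, x.1 < p := by
        intro x hx
        have h1 := hQ x (mem_of_mem_erase hx)
        have h2 : x ≠ q := ne_of_mem_erase hx
        have h3 : x.1 ≠ p := fun h => h2 (Fin.ext h)
        omega
      have e1 := hcnt Q0 hQ0lt (by omega)
      have e2 := hunsel Q0 hQ0lt (by omega)
      have e3 : #{e | S' e = Q} + #{e | Sum.inl e ∉ s ∧ S e = Q0} = #{e | S e = Q0} := by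
        rw [← card_union_of_disjoint]
        · congr 1
          ext e
          simp only [mem_union, mem_filter, mem_univ, true_and]
          by_cases he : Sum.inl e ∈ s
          · rw [hSone e he]
            simp only [he, not_true_eq_false, false_and, or_false]
            constructor
            · rintro h; rw [hQ0, ← h, erase_insert (hq e)]
            · rintro h; rw [h, hQ0, insert_erase hqQ]
          · rw [hSzero e he]
            simp only [he, not_false_eq_true, true_and, or_iff_right_iff_imp]
            rintro rfl
            exact absurd hqQ (hq e)
        · rw [disjoint_left]
          intro e h1 h2
          simp only [mem_filter, mem_univ, true_and] at h1 h2
          exact h2.1 ((hqS e).1 (h1 ▸ hqQ))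
      have e4 : r - #Q0 = (r - #Q) + 1 := by omega
      rw [e4] at e1 e2
      rw [Nat.choose_succ_succ] at e1
      simp only [Nat.succ_eq_add_one] at e1
      omega
    · have hQlt : ∀ x ∈ Q, x.1 < p := by
        intro x hx
        have h1 := hQ x hx
        have h3 : x.1 ≠ p := fun h => hqQ ((Fin.ext h : x = q) ▸ hx)
        omega
      rw [← hunsel Q hQlt hQr]
      congr 1
      ext e
      simp only [mem_filter, mem_univ, true_and]
      by_cases he : Sum.inl e ∈ s
      · simp only [he, not_true_eq_false, false_and, iff_false]
        rintro rfl
        exact hqQ ((hqS e).2 he)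
      · rw [hSzero e he]; simp [he]
  · intro j hj
    obtain ⟨h1, h2⟩ := hge j hj
    obtain ⟨σ, hσ, hσ0, hσe⟩ := hrow j
    have := arith_ge (by omega) (hwJ j) hσ hσ0 hσe h2
    have h3 := hT' j
    refine ⟨?_, by omega⟩
    intro x hx
    by_cases hxq : x = q
    · obtain ⟨e, he⟩ := card_pos.1 this.1
      simp only [mem_filter, mem_univ, true_and] at he
      exact ⟨e, he.2, hxq ▸ (hqS e).2 he.1⟩
    · have h3 : x.1 ≠ p := fun h => hxq (Fin.ext h)
      obtain ⟨e, he, hxe⟩ := h1 x (by omega)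
      exact ⟨e, he, (hxS e x hxq).2 hxe⟩
  · intro j hj
    obtain ⟨h1, h2⟩ := hle j hj
    obtain ⟨σ, hσ, hσ0, hσe⟩ := hrow j
    have := arith_le (by omega) rfl hσ hσ0 hσe h2
    have h3 := hT' j
    refine ⟨?_, by omega⟩
    intro x e e' he he' hx hx'
    by_cases hxq : x = q
    · subst hxq
      rw [hqS] at hx hx'
      exact card_le_one.1 this.1 e (by simp [hx, he]) e' (by simp [hx', he'])
    · exact h1 x e e' he he' ((hxS e x hxq).1 hx) ((hxS e' x hxq).1 hx')

/-- Baranyai's theorem in the form needed. -/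
theorem baranyai {E J : Type} [Fintype E] [Fintype J] [DecidableEq E] [DecidableEq J]
    (m r : ℕ) (cls : E → J) (hE : Fintype.card E = m.choose r) :
    ∃ S : E → Finset (Fin m), Function.Injective S ∧ (∀ e, #(S e) = r) ∧
      ∀ j, min m (#{e | cls e = j} * r) ≤ #(({e | cls e = j} : Finset E).biUnion S) := by
  have key : ∀ p, p ≤ m → ∃ S, BInv m r cls p S := by
    intro p
    induction p with
    | zero =>
      intro _
      refine ⟨fun _ => ∅, by simp, by simp, ?_, ?_, ?_⟩
      · intro Q hQ _
        have : Q = ∅ := eq_empty_of_forall_notMem fun x hx => by simpa using hQ x hx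
        subst this
        simp [hE]
      · intro j hj; simpa using hj
      · intro j hj; simpa using hj
    | succ p ih =>
      intro hp
      obtain ⟨S, hS⟩ := ih (by omega)
      exact BInv_step m r cls p hp S hS
  obtain ⟨S, hr, hlt, hcnt, hge, hle⟩ := key m le_rfl
  simp only [Nat.sub_self] at hcnt
  have hc : ∀ e, #(S e) = r := by
    intro e
    have h1 := hcnt (S e) (hlt e) (hr e)
    have h2 : 0 < #{e' | S e' = S e} := card_pos.2 ⟨e, by simp⟩
    have := hr e
    by_contra hc
    rw [h1, Nat.choose_eq_zero_of_lt (by omega)] at h2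
    omega
  refine ⟨S, ?_, hc, ?_⟩
  · intro e e' hee
    have h1 := hcnt (S e) (hlt e) (hr e)
    rw [hc e, Nat.sub_self, Nat.choose_zero_right] at h1
    exact card_le_one.1 h1.le e (by simp) e' (by simp [hee])
  · intro j
    rcases le_total m (#{e | cls e = j} * r) with h | h
    · refine le_trans (min_le_left _ _) ?_
      have : (({e | cls e = j} : Finset E).biUnion S) = univ := by
        ext x
        obtain ⟨e, he, hx⟩ := (hge j h).1 x x.2
        simp only [mem_biUnion, mem_filter, mem_univ, true_and, iff_true]
        exact ⟨e, he, hx⟩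
      rw [this]; simp
    · refine le_trans (min_le_right _ _) ?_
      rw [card_biUnion]
      · simp [hc]
      · intro e he e' he' hne
        rw [mem_coe, mem_filter] at he he'
        rw [Function.onFun, disjoint_left]
        exact fun x hx hx' => hne ((hle j h).1 x e e' he.2 he'.2 hx hx')

/-- **Partition lemma (Xu–Zhou, Lemma 4).** Let `n ≥ 2k ≥ 4`, let `i, l ≥ 1` with
`i ≤ n−k+1`, and let `c = ⌊binom(n−i,k−1)/l⌋`. Then `|𝒜_i(n,k)| = binom(n−i,k−1)`,
and `𝒜_i(n,k)` can be partitioned into subfamilies `P 1, …, P c` each of size `l`,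
together with one further subfamily `R` of size `binom(n−i,k−1) − c·l` (which is empty
exactly when `l` divides `binom(n−i,k−1)`), such that for each `j` the union of the
members of `P j` has size at least `min (n−i+1) (l(k−1)+1)`. -/
theorem partition_clique_family (n k i l : ℕ) (hk : 2 ≤ k) (hn : 2 * k ≤ n)
    (hi : 1 ≤ i) (hl : 1 ≤ l) (hin : i ≤ n - k + 1) :
    (kneserFamilyA n k i).card = (n - i).choose (k - 1) ∧
    ∃ (P : Fin ((n - i).choose (k - 1) / l) → Finset (Finset ℕ))
      (R : Finset (Finset ℕ)),
      (∀ j j', j ≠ j' → Disjoint (P j) (P j')) ∧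
      (∀ j, Disjoint (P j) R) ∧
      (Finset.univ.biUnion P) ∪ R = kneserFamilyA n k i ∧
      (∀ j, (P j).card = l) ∧
      R.card = (n - i).choose (k - 1) - ((n - i).choose (k - 1) / l) * l ∧
      (∀ j, min (n - i + 1) (l * (k - 1) + 1) ≤ ((P j).biUnion id).card) := by
  obtain ⟨m, hm⟩ : ∃ m, m = n - i := ⟨_, rfl⟩
  obtain ⟨r, hr⟩ : ∃ r, r = k - 1 := ⟨_, rfl⟩
  rw [← hm, ← hr]
  let sh : Fin m ↪ ℕ := ⟨fun x => i + 1 + x.1, fun x y h => Fin.ext (by simpa using h)⟩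
  have hsh : ∀ x, i < sh x ∧ sh x ≤ n := fun x => by
    have := x.2
    change i < i + 1 + x.1 ∧ i + 1 + x.1 ≤ n
    omega
  let g : Finset (Fin m) → Finset ℕ := fun Q => insert i (Q.map sh)
  have hni : ∀ Q : Finset (Fin m), i ∉ Q.map sh := by
    intro Q h
    obtain ⟨x, _, hx⟩ := mem_map.1 h
    have := hsh x; omega
  have ginj : Function.Injective g := by
    intro Q Q' h
    have : (g Q).erase i = (g Q').erase i := by rw [h]
    simp only [g, erase_insert (hni _)] at this
    exact map_injective sh this
  have gcard : ∀ Q, #(g Q) = #Q + 1 := by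
    intro Q; simp only [g]; rw [card_insert_of_notMem (hni _), card_map]
  have hfam : kneserFamilyA n k i = (univ.powersetCard r).image g := by
    ext A
    simp only [kneserFamilyA, mem_filter, mem_powersetCard, mem_image, subset_univ, true_and]
    constructor
    · rintro ⟨⟨h1, h2⟩, h3, h4⟩
      have hg : g (univ.filter fun x => sh x ∈ A) = A := by
        ext y
        simp only [g, mem_insert, mem_map, mem_filter, mem_univ, true_and]
        constructor
        · rintro (rfl | ⟨x, hx, rfl⟩)
          · exact h3
          · exact hx
        · intro hy
          by_cases hyi : y = i
          · exact Or.inl hyi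
          · have := mem_Icc.1 (h4 (mem_sdiff.2 ⟨hy, by simpa using hyi⟩))
            have e : sh ⟨y - (i + 1), by omega⟩ = y := by
              change i + 1 + (y - (i + 1)) = y
              omega
            exact Or.inr ⟨⟨y - (i + 1), by omega⟩, by rw [e]; exact hy, e⟩
      refine ⟨_, ?_, hg⟩
      have := gcard (univ.filter fun x => sh x ∈ A)
      rw [hg] at this
      omega
    · rintro ⟨Q, hQ, rfl⟩
      refine ⟨⟨?_, by rw [gcard]; omega⟩, by simp [g], ?_⟩
      · intro y hy
        simp only [g, mem_insert, mem_map] at hy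
        rw [mem_Icc]
        rcases hy with rfl | ⟨x, hx, rfl⟩
        · omega
        · have := hsh x; omega
      · intro y hy
        simp only [g, mem_sdiff, mem_insert, mem_map, mem_singleton] at hy
        rw [mem_Icc]
        rcases hy with ⟨rfl | ⟨x, hx, rfl⟩, hy⟩
        · omega
        · have := hsh x; omega
  have hcard : #(kneserFamilyA n k i) = m.choose r := by
    rw [hfam, card_image_of_injective _ ginj, card_powersetCard]; simp
  refine ⟨hcard, ?_⟩
  set C := m.choose r with hC
  let cls : Fin C → Fin (C / l + 1) := fun e =>
    ⟨e.1 / l, Nat.lt_succ_of_le (Nat.div_le_div_right e.2.le)⟩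
  obtain ⟨S, Sinj, Sc, Su⟩ := baranyai m r cls (by simp [hC])
  let G : Fin C → Finset ℕ := fun e => g (S e)
  have Ginj : Function.Injective G := ginj.comp Sinj
  let cl : Fin (C / l) → Finset (Fin C) := fun j => {e | cls e = j.castSucc}
  have mem_cl : ∀ j e, e ∈ cl j ↔ e.1 / l = j.1 := by
    intro j e
    simp [cl, cls, Fin.ext_iff]
  have clcard : ∀ j, #(cl j) = l := by
    intro j
    have hj : (j.1 + 1) * l ≤ C :=
      le_trans (Nat.mul_le_mul_right l j.2) (Nat.div_mul_le_self C l)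
    have : (cl j).map Fin.valEmbedding = Ico (j.1 * l) ((j.1 + 1) * l) := by
      ext x
      simp only [mem_map, mem_cl, Fin.valEmbedding_apply, mem_Ico]
      constructor
      · rintro ⟨e, he, rfl⟩
        rw [Nat.div_eq_iff hl] at he
        rw [add_mul, one_mul]; omega
      · intro hx
        exact ⟨⟨x, by omega⟩, (Nat.div_eq_iff hl).2 (by
          rw [add_mul, one_mul] at hx
          change j.1 * l ≤ x ∧ x ≤ j.1 * l + l - 1
          omega), rfl⟩
    rw [← card_map Fin.valEmbedding, this, Nat.card_Ico, add_mul, one_mul]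
    omega
  let P : Fin (C / l) → Finset (Finset ℕ) := fun j => (cl j).image G
  have Pdisj : ∀ j j', j ≠ j' → Disjoint (P j) (P j') := by
    intro j j' hne
    rw [disjoint_image Ginj, disjoint_left]
    intro e h1 h2
    rw [mem_cl] at h1 h2
    exact hne (Fin.ext (h1.symm.trans h2))
  have Pcard : ∀ j, #(P j) = l := fun j => by rw [card_image_of_injective _ Ginj, clcard]
  have Psub : univ.biUnion P ⊆ kneserFamilyA n k i := by
    intro A hA
    simp only [P, mem_biUnion, mem_image, mem_univ, true_and] at hA
    obtain ⟨j, e, _, rfl⟩ := hA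
    rw [hfam]
    exact mem_image_of_mem _ (mem_powersetCard.2 ⟨subset_univ _, Sc e⟩)
  refine ⟨P, kneserFamilyA n k i \ univ.biUnion P, Pdisj, ?_, ?_, Pcard, ?_, ?_⟩
  · intro j
    exact disjoint_sdiff.mono_left (subset_biUnion_of_mem P (mem_univ j))
  · exact union_sdiff_of_subset Psub
  · rw [card_sdiff_of_subset Psub, hcard, card_biUnion (fun j _ j' _ h => Pdisj j j' h)]
    simp [Pcard]
  · intro j
    have h1 := Su j.castSucc
    change min m (#(cl j) * r) ≤ #((cl j).biUnion S) at h1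
    rw [clcard] at h1
    have hne : (cl j).Nonempty := card_pos.1 (by rw [clcard]; omega)
    have : (P j).biUnion id = g ((cl j).biUnion S) := by
      obtain ⟨e0, he0⟩ := hne
      ext y
      simp only [P, G, g, mem_biUnion, mem_image, id, mem_insert, mem_map]
      constructor
      · rintro ⟨_, ⟨e, he, rfl⟩, hy⟩
        simp only [mem_insert, mem_map] at hy
        rcases hy with rfl | ⟨x, hx, rfl⟩
        · exact Or.inl rfl
        · exact Or.inr ⟨x, ⟨e, he, hx⟩, rfl⟩
      · rintro (rfl | ⟨x, ⟨e, he, hx⟩, rfl⟩)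
        · exact ⟨_, ⟨e0, he0, rfl⟩, by simp⟩
        · exact ⟨_, ⟨e, he, rfl⟩, by simp [hx]⟩
    rw [this, gcard]
    omega
end
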